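/- arXiv:1707.08453 — 2 statements merged into one kernel-verified Lean document; each statement's English description precedes it below -/
import Mathlib

section
/- Assume the Case (A) setup and let v = (0, 0, a2·a4, a2·a3). Then for every integer w > 0 such that gcd(n1, n2, n3 + w·a2·a4, n4 + w·a2·a3) = 1, the toric ideal I(n + w·v) equals the ideal of K[x1,x2,x3,x4] generated by f1, f2 and x1^{u1+w}x2^{u2} − x3^{u3}x4^{u4}; in particular it is a complete intersection. -/
open MvPolynomial

/-- The toric ideal of the monomial curve `(t^{n 0}, t^{n 1}, t^{n 2}, t^{n 3})`:
the kernel of the `K`-algebra map `K[x₁,x₂,x₃,x₄] → K[t]`, `xᵢ ↦ t^{n i}`. -/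
noncomputable def toricIdeal (K : Type*) [Field K] (n : Fin 4 → ℕ) :
    Ideal (MvPolynomial (Fin 4) K) :=
  RingHom.ker (aeval (fun i => (Polynomial.X : Polynomial K) ^ n i) :
    MvPolynomial (Fin 4) K →ₐ[K] Polynomial K)

/-- The toric ideal lies in every ideal modulo which any two monomials of equal weighted degree
agree. -/
theorem toricIdeal_le {K : Type*} [Field K] (n : Fin 4 → ℕ) (J : Ideal (MvPolynomial (Fin 4) K))
    (h : ∀ s t : Fin 4 →₀ ℕ, ∑ i, n i * s i = ∑ i, n i * t i →
      Ideal.Quotient.mk J (monomial s 1) = Ideal.Quotient.mk J (monomial t 1)) :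
    toricIdeal K n ≤ J := by
  classical
  let φ : ℕ → MvPolynomial (Fin 4) K ⧸ J := fun d =>
    if hd : ∃ s : Fin 4 →₀ ℕ, ∑ i, n i * s i = d then
      Ideal.Quotient.mk J (monomial hd.choose 1) else 0
  have hφ : ∀ s : Fin 4 →₀ ℕ, φ (∑ i, n i * s i) = Ideal.Quotient.mk J (monomial s 1) := by
    intro s
    have hd : ∃ t : Fin 4 →₀ ℕ, ∑ i, n i * t i = ∑ i, n i * s i := ⟨s, rfl⟩
    simp only [φ, dif_pos hd]
    exact h _ _ hd.choose_spec
  let L := (Polynomial.basisMonomials K).constr K φ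
  have hL : L ∘ₗ (aeval (fun i => (Polynomial.X : Polynomial K) ^ n i) :
      MvPolynomial (Fin 4) K →ₐ[K] Polynomial K).toLinearMap =
      (Ideal.Quotient.mkₐ K J).toLinearMap := by
    refine (basisMonomials (Fin 4) K).ext fun s => ?_
    have hX : (aeval (fun i => (Polynomial.X : Polynomial K) ^ n i) :
        MvPolynomial (Fin 4) K →ₐ[K] Polynomial K) (monomial s 1) =
        Polynomial.basisMonomials K (∑ i, n i * s i) := by
      rw [aeval_monomial, Finsupp.prod_fintype _ _ (by simp)]
      simp only [← pow_mul, Finset.prod_pow_eq_pow_sum, map_one, one_mul,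
        Polynomial.coe_basisMonomials, ← Polynomial.X_pow_eq_monomial]
    simp only [coe_basisMonomials, LinearMap.comp_apply, AlgHom.toLinearMap_apply, hX]
    rw [Module.Basis.constr_basis, hφ]
    rfl
  intro p hp
  have hp' : (aeval (fun i => (Polynomial.X : Polynomial K) ^ n i) :
      MvPolynomial (Fin 4) K →ₐ[K] Polynomial K) p = 0 := hp
  have := LinearMap.congr_fun hL p
  simp only [LinearMap.comp_apply, AlgHom.toLinearMap_apply, hp', map_zero] at this
  exact Ideal.Quotient.eq_zero_iff_mem.mp this.symm

/-- If `x ^ a = y ^ b` with `a`, `b` coprime, then `x ^ i * y ^ j` depends only on `b * i + a * j`. -/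
theorem pow_mul_pow_eq_of_weight_eq {M : Type*} [CommMonoid M] {x y : M} {a b : ℕ} (ha : 0 < a)
    (hab : a.Coprime b) (hxy : x ^ a = y ^ b) {i j i' j' : ℕ}
    (h : b * i + a * j = b * i' + a * j') : x ^ i * y ^ j = x ^ i' * y ^ j' := by
  wlog hi : i ≤ i' generalizing i j i' j'
  · exact (this h.symm (by omega)).symm
  obtain ⟨d, rfl⟩ := Nat.exists_eq_add_of_le hi
  have hd : a * j = b * d + a * j' := by linarith
  obtain ⟨m, rfl⟩ : a ∣ d := hab.dvd_of_dvd_mul_left <|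
    (Nat.dvd_add_left (dvd_mul_right a j')).mp (hd ▸ dvd_mul_right a j)
  obtain rfl : j = b * m + j' := Nat.eq_of_mul_eq_mul_left ha (by linarith)
  rw [pow_add, pow_add, pow_mul, pow_mul, hxy, mul_assoc]

/-- In a commutative monoid satisfying the three binomial relations, monomials of equal weighted
degree agree. -/
theorem monomial_eq_of_weight_eq {M : Type*} [CommMonoid M] {x y z w : M}
    {a b c d p q r s : ℕ} (ha : 0 < a) (hc : 0 < c) (hab : a.Coprime b) (hcd : c.Coprime d)
    (hE : 0 < a * q + p * b)
    (hDE : (c * s + r * d).Coprime (a * q + p * b))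
    (hxy : x ^ a = y ^ b) (hzw : z ^ c = w ^ d) (hf : x ^ p * y ^ q = z ^ r * w ^ s)
    {i j k l i' j' k' l' : ℕ}
    (h : (b * i + a * j) * (c * s + r * d) + (d * k + c * l) * (a * q + p * b) =
      (b * i' + a * j') * (c * s + r * d) + (d * k' + c * l') * (a * q + p * b)) :
    x ^ i * y ^ j * (z ^ k * w ^ l) = x ^ i' * y ^ j' * (z ^ k' * w ^ l') := by
  wlog hi : b * i' + a * j' ≤ b * i + a * j generalizing i j k l i' j' k' l'
  · exact (this h.symm (by omega)).symm
  obtain ⟨e, he⟩ := Nat.exists_eq_add_of_le hi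
  have h1 : e * (c * s + r * d) + (d * k + c * l) * (a * q + p * b) =
      (d * k' + c * l') * (a * q + p * b) := by
    rw [he] at h; linarith
  obtain ⟨m, rfl⟩ : a * q + p * b ∣ e := hDE.symm.dvd_of_dvd_mul_right <|
    (Nat.dvd_add_left (dvd_mul_left _ (d * k + c * l))).mp (h1 ▸ dvd_mul_left _ _)
  have hxy' : x ^ i * y ^ j = x ^ (i' + p * m) * y ^ (j' + q * m) :=
    pow_mul_pow_eq_of_weight_eq ha hab hxy (by rw [he]; ring)
  have hpow : (x ^ p * y ^ q) ^ m = (z ^ r * w ^ s) ^ m := by rw [hf]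
  have hzw' : z ^ k' * w ^ l' = z ^ (k + r * m) * w ^ (l + s * m) :=
    pow_mul_pow_eq_of_weight_eq hc hcd hzw (Nat.eq_of_mul_eq_mul_right hE (by rw [← h1]; ring))
  calc x ^ i * y ^ j * (z ^ k * w ^ l)
      = x ^ i' * y ^ j' * ((x ^ p * y ^ q) ^ m * (z ^ k * w ^ l)) := by
        rw [hxy', pow_add, pow_add, mul_pow, ← pow_mul, ← pow_mul]; ac_rfl
    _ = x ^ i' * y ^ j' * (z ^ k' * w ^ l') := by
        rw [hpow, hzw', pow_add, pow_add, mul_pow, ← pow_mul, ← pow_mul]; ac_rfl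

theorem stmt4 (K : Type*) [Field K] (a1 a2 a3 a4 u1 u2 u3 u4 : ℕ)
    (ha1 : 0 < a1) (ha2 : 0 < a2) (ha3 : 0 < a3) (ha4 : 0 < a4)
    (hu12 : ¬(u1 = 0 ∧ u2 = 0)) (hu34 : ¬(u3 = 0 ∧ u4 = 0))
    (n : Fin 4 → ℕ)
    (hn : n = ![a2 * (a3 * u4 + u3 * a4), a1 * (a3 * u4 + u3 * a4),
      a4 * (a1 * u2 + u1 * a2), a3 * (a1 * u2 + u1 * a2)])
    (v : Fin 4 → ℕ) (hv : v = ![0, 0, a2 * a4, a2 * a3]) :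
    ∀ w : ℕ, 0 < w →
      Nat.gcd (Nat.gcd (Nat.gcd (n 0 + w * v 0) (n 1 + w * v 1))
        (n 2 + w * v 2)) (n 3 + w * v 3) = 1 →
      toricIdeal K (fun j => n j + w * v j) =
        Ideal.span {(X 0 : MvPolynomial (Fin 4) K) ^ a1 - X 1 ^ a2,
          X 2 ^ a3 - X 3 ^ a4,
          X 0 ^ (u1 + w) * X 1 ^ u2 - X 2 ^ u3 * X 3 ^ u4} ∧
      ∃ g1 g2 g3 : MvPolynomial (Fin 4) K,
        toricIdeal K (fun j => n j + w * v j) = Ideal.span {g1, g2, g3} := by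
  subst hn hv
  intro w hw hgcd
  simp only [Matrix.cons_val_zero, Matrix.cons_val_one, Matrix.cons_val, mul_zero,
    add_zero] at hgcd
  set J : Ideal (MvPolynomial (Fin 4) K) := Ideal.span {(X 0 : MvPolynomial (Fin 4) K) ^ a1 -
    X 1 ^ a2, X 2 ^ a3 - X 3 ^ a4, X 0 ^ (u1 + w) * X 1 ^ u2 - X 2 ^ u3 * X 3 ^ u4} with hJ
  refine (fun H => ⟨H, _, _, _, H⟩ : _ = J → _) (le_antisymm ?_ ?_)
  · have h3 : a4 * (a1 * u2 + u1 * a2) + w * (a2 * a4) = a4 * (a1 * u2 + (u1 + w) * a2) := by ring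
    have h4 : a3 * (a1 * u2 + u1 * a2) + w * (a2 * a3) = a3 * (a1 * u2 + (u1 + w) * a2) := by ring
    rw [h3, h4] at hgcd
    have key : ∀ g : ℕ, g ∣ a2 * (a3 * u4 + u3 * a4) → g ∣ a1 * (a3 * u4 + u3 * a4) →
        g ∣ a4 * (a1 * u2 + (u1 + w) * a2) → g ∣ a3 * (a1 * u2 + (u1 + w) * a2) → g = 1 :=
      fun g g1 g2 g3 g4 => Nat.dvd_one.mp
        (hgcd ▸ Nat.dvd_gcd (Nat.dvd_gcd (Nat.dvd_gcd g1 g2) g3) g4)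
    have hDE : (a3 * u4 + u3 * a4).Coprime (a1 * u2 + (u1 + w) * a2) :=
      key _ ((Nat.gcd_dvd_left _ _).mul_left _) ((Nat.gcd_dvd_left _ _).mul_left _)
        ((Nat.gcd_dvd_right _ _).mul_left _) ((Nat.gcd_dvd_right _ _).mul_left _)
    have h12 : a1.Coprime a2 := key _ ((Nat.gcd_dvd_right _ _).mul_right _)
      ((Nat.gcd_dvd_left _ _).mul_right _)
      (Dvd.dvd.mul_left (dvd_add ((Nat.gcd_dvd_left _ _).mul_right _)
        ((Nat.gcd_dvd_right _ _).mul_left _)) _)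
      (Dvd.dvd.mul_left (dvd_add ((Nat.gcd_dvd_left _ _).mul_right _)
        ((Nat.gcd_dvd_right _ _).mul_left _)) _)
    have h34 : a3.Coprime a4 := key _
      (Dvd.dvd.mul_left (dvd_add ((Nat.gcd_dvd_left _ _).mul_right _)
        ((Nat.gcd_dvd_right _ _).mul_left _)) _)
      (Dvd.dvd.mul_left (dvd_add ((Nat.gcd_dvd_left _ _).mul_right _)
        ((Nat.gcd_dvd_right _ _).mul_left _)) _)
      ((Nat.gcd_dvd_right _ _).mul_right _) ((Nat.gcd_dvd_left _ _).mul_right _)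
    have hE : 0 < a1 * u2 + (u1 + w) * a2 := by positivity
    have r1 := Ideal.Quotient.eq.mpr (show X 0 ^ a1 - X 1 ^ a2 ∈ J from
      Ideal.subset_span (by simp))
    have r2 := Ideal.Quotient.eq.mpr (show X 2 ^ a3 - X 3 ^ a4 ∈ J from
      Ideal.subset_span (by simp))
    have r3 := Ideal.Quotient.eq.mpr (show X 0 ^ (u1 + w) * X 1 ^ u2 - X 2 ^ u3 * X 3 ^ u4 ∈ J from
      Ideal.subset_span (by simp))
    simp only [map_mul, map_pow] at r1 r2 r3
    refine toricIdeal_le _ J fun s t hst => ?_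
    have hmon : ∀ s : Fin 4 →₀ ℕ, (monomial s 1 : MvPolynomial (Fin 4) K) =
        X 0 ^ s 0 * X 1 ^ s 1 * (X 2 ^ s 2 * X 3 ^ s 3) := by
      intro s
      rw [monomial_eq, Finsupp.prod_fintype _ _ (by simp)]
      simp [Fin.prod_univ_four, mul_assoc]
    rw [hmon, hmon]
    simp only [map_mul, map_pow]
    refine monomial_eq_of_weight_eq ha1 ha3 h12 h34 hE hDE r1 r2 r3 ?_
    simp only [Fin.sum_univ_four, Matrix.cons_val_zero, Matrix.cons_val_one, Matrix.cons_val,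
      mul_zero, add_zero] at hst
    linarith
  · rw [hJ, Ideal.span_le]
    rintro f (rfl | rfl | rfl) <;>
    · simp only [toricIdeal, SetLike.mem_coe, RingHom.mem_ker, map_sub, map_mul, map_pow, aeval_X,
        Matrix.cons_val_zero, Matrix.cons_val_one, Matrix.cons_val, mul_zero, add_zero,
        ← pow_mul, ← pow_add, sub_eq_zero]
      ring_nf
end

section
/- Assume the Case (A) setup with gcd(n1,n2,n3,n4) = 1, n1 = min{n1,n2,n3,n4}, a3 < a4, u2 ≤ a2 and u3 ≤ a3, and let d1 = (0, 0, a2·a4, a2·a3) and d2 = (0, 0, a1·a4, a1·a3). Then there exists a nonnegative integer w0 such that for all integers w ≥ w0: if the four entries of n + w·d1 have greatest common divisor 1 then the image of x1 is a nonzerodivisor in K[x1,x2,x3,x4]/I(n + w·d1)_*, and if the four entries of n + w·d2 have greatest common divisor 1 then the image of x1 is a nonzerodivisor in K[x1,x2,x3,x4]/I(n + w·d2)_*. -/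
open MvPolynomial

/-- The ideal `I_*` generated by the least-degree nonzero homogeneous components `f_*`
of the nonzero elements `f ∈ I`. -/
noncomputable def idealStar {K : Type*} [Field K] (I : Ideal (MvPolynomial (Fin 4) K)) :
    Ideal (MvPolynomial (Fin 4) K) :=
  Ideal.span {g | ∃ f ∈ I, f ≠ 0 ∧ ∃ d : ℕ,
    (∀ e < d, homogeneousComponent e f = 0) ∧
    homogeneousComponent d f ≠ 0 ∧ g = homogeneousComponent d f}

/-- The monomial exponent `m` has the largest total degree among those of its weight. -/
def IsMaxDegree (n : Fin 4 → ℕ) (m : Fin 4 →₀ ℕ) : Prop :=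
  ∀ m', Finsupp.weight n m' = Finsupp.weight n m → m'.degree ≤ m.degree

open Classical in
/-- The linear map sending a monomial to its weight if it has the largest total degree among
the monomials of that weight, and to zero otherwise. -/
noncomputable def maxDegreePart (K : Type*) [Field K] (n : Fin 4 → ℕ) :
    MvPolynomial (Fin 4) K →ₗ[K] (ℕ →₀ K) :=
  (basisMonomials (Fin 4) K).constr K
    fun m => if IsMaxDegree n m then Finsupp.single (Finsupp.weight n m) 1 else 0

section

variable {K : Type*} [Field K] {n : Fin 4 → ℕ}

open Classical in
theorem maxDegreePart_monomial (m : Fin 4 →₀ ℕ) (c : K) :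
    maxDegreePart K n (monomial m c) =
      if IsMaxDegree n m then Finsupp.single (Finsupp.weight n m) c else 0 := by
  have h : monomial m c = c • basisMonomials (Fin 4) K m := by
    simp [smul_monomial]
  rw [h, map_smul, maxDegreePart, Module.Basis.constr_basis]
  split_ifs <;> simp

theorem aeval_X_pow_monomial (m : Fin 4 →₀ ℕ) (c : K) :
    aeval (fun i => (Polynomial.X : Polynomial K) ^ n i) (monomial m c) =
      Polynomial.monomial (Finsupp.weight n m) c := by
  rw [aeval_monomial, Finsupp.prod_fintype _ _ (by simp), Finsupp.weight_apply,
    Finsupp.sum_fintype _ _ (by simp), ← Polynomial.C_mul_X_pow_eq_monomial]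
  congr 1
  simp only [← pow_mul, smul_eq_mul, Finset.prod_pow_eq_pow_sum]
  simp only [mul_comm]

theorem monomial_sub_monomial_mem_toricIdeal {m m' : Fin 4 →₀ ℕ}
    (h : Finsupp.weight n m = Finsupp.weight n m') :
    (monomial m 1 - monomial m' 1 : MvPolynomial (Fin 4) K) ∈ toricIdeal K n := by
  rw [toricIdeal, RingHom.mem_ker]
  rw [map_sub, aeval_X_pow_monomial, aeval_X_pow_monomial, h, sub_self]

theorem homogeneousComponent_mem_idealStar {I : Ideal (MvPolynomial (Fin 4) K)}
    {f : MvPolynomial (Fin 4) K} (hf : f ∈ I) {d : ℕ}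
    (hd : ∀ e < d, homogeneousComponent e f = 0) :
    homogeneousComponent d f ∈ idealStar I := by
  by_cases h : homogeneousComponent d f = 0
  · rw [h]; exact zero_mem _
  · exact Ideal.subset_span ⟨f, hf, fun h0 => h (by rw [h0, map_zero]), d, hd, h, rfl⟩

theorem homogeneousComponent_monomial (e : ℕ) (m : Fin 4 →₀ ℕ) (c : K) :
    homogeneousComponent e (monomial m c) = if m.degree = e then monomial m c else 0 := by
  ext m'
  rw [coeff_homogeneousComponent]
  split_ifs <;> simp only [coeff_monomial, coeff_zero] <;> grind

theorem maxDegreePart_homogeneousComponent_eq_zero {f : MvPolynomial (Fin 4) K}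
    (hf : f ∈ toricIdeal K n) {d : ℕ} (hd : ∀ e < d, homogeneousComponent e f = 0) :
    maxDegreePart K n (homogeneousComponent d f) = 0 := by
  classical
  have hdeg : ∀ m ∈ f.support, d ≤ m.degree := by
    intro m hm
    by_contra! hlt
    have := congrArg (coeff m) (hd _ hlt)
    rw [coeff_homogeneousComponent, if_pos rfl, coeff_zero] at this
    exact mem_support_iff.mp hm this
  ext s
  rw [homogeneousComponent_apply, map_sum, Finsupp.finsetSum_apply, Finsupp.zero_apply]
  by_cases hs : ∃ m₀, IsMaxDegree n m₀ ∧ m₀.degree = d ∧ Finsupp.weight n m₀ = s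
  · obtain ⟨m₀, hmax, hm₀, hw⟩ := hs
    have h0 : (aeval (fun i => (Polynomial.X : Polynomial K) ^ n i) f).coeff s = 0 := by
      rw [toricIdeal, RingHom.mem_ker] at hf
      rw [hf, Polynomial.coeff_zero]
    rw [f.as_sum, map_sum, Polynomial.finsetSum_coeff] at h0
    rw [← h0, Finset.sum_filter]
    refine Finset.sum_congr rfl fun m hm => ?_
    rw [aeval_X_pow_monomial, Polynomial.coeff_monomial, maxDegreePart_monomial]
    by_cases hms : Finsupp.weight n m = s
    · have h1 : m.degree = d :=
        le_antisymm (hm₀ ▸ hmax m (hms.trans hw.symm)) (hdeg m hm)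
      have h2 : IsMaxDegree n m := fun m' hm' => by
        rw [h1, ← hm₀]; exact hmax m' (by rw [hm', hms, hw])
      simp [h1, h2, hms]
    · split_ifs <;> simp [hms]
  · refine Finset.sum_eq_zero fun m hm => ?_
    rw [maxDegreePart_monomial]
    split_ifs with hmax
    · rw [Finsupp.single_apply, if_neg]
      exact fun h => hs ⟨m, hmax, (Finset.mem_filter.mp hm).2, h⟩
    · rfl

theorem homogeneousComponent_monomial_mul (μ : Fin 4 →₀ ℕ) (c : K)
    (f : MvPolynomial (Fin 4) K) (d : ℕ) :
    homogeneousComponent (μ.degree + d) (monomial μ c * f) =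
      monomial μ c * homogeneousComponent d f := by
  classical
  ext m
  rw [coeff_homogeneousComponent, coeff_monomial_mul', coeff_monomial_mul',
    coeff_homogeneousComponent]
  by_cases h : μ ≤ m
  · obtain ⟨k, rfl⟩ := exists_add_of_le h
    simp
  · simp [h]

theorem homogeneousComponent_monomial_mul_eq_zero (μ : Fin 4 →₀ ℕ) (c : K)
    {f : MvPolynomial (Fin 4) K} {d : ℕ} (hd : ∀ e < d, homogeneousComponent e f = 0) :
    ∀ e < μ.degree + d, homogeneousComponent e (monomial μ c * f) = 0 := by
  classical
  intro e he
  obtain h | h := le_or_gt μ.degree e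
  · obtain ⟨k, rfl⟩ := exists_add_of_le h
    rw [homogeneousComponent_monomial_mul, hd k (by omega), mul_zero]
  · ext m
    rw [coeff_homogeneousComponent, coeff_monomial_mul', coeff_zero]
    split_ifs with h1 h2
    · have := Finsupp.degree_mono h2
      omega
    · rfl
    · rfl

theorem maxDegreePart_eq_zero_of_mem {p : MvPolynomial (Fin 4) K}
    (hp : p ∈ idealStar (toricIdeal K n)) : maxDegreePart K n p = 0 := by
  suffices h : ∀ q, maxDegreePart K n (q * p) = 0 by simpa using h 1
  refine Submodule.span_induction (p := fun p _ => ∀ q, maxDegreePart K n (q * p) = 0)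
    ?_ ?_ ?_ ?_ hp
  · rintro _ ⟨f, hf, -, d, hd, -, rfl⟩ q
    induction q using MvPolynomial.induction_on' with
    | monomial μ c =>
      rw [← homogeneousComponent_monomial_mul]
      exact maxDegreePart_homogeneousComponent_eq_zero (Ideal.mul_mem_left _ _ hf)
        (homogeneousComponent_monomial_mul_eq_zero μ c hd)
    | add p q hp hq => rw [add_mul, map_add, hp, hq, add_zero]
  · simp
  · intro x y _ _ hx hy q
    rw [mul_add, map_add, hx, hy, add_zero]
  · intro a x _ hx q
    rw [smul_eq_mul, ← mul_assoc, hx]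

theorem monomial_mem_idealStar {m : Fin 4 →₀ ℕ} (hm : ¬ IsMaxDegree n m) :
    (monomial m 1 : MvPolynomial (Fin 4) K) ∈ idealStar (toricIdeal K n) := by
  simp only [IsMaxDegree, not_forall, not_le] at hm
  obtain ⟨m', hw, hlt⟩ := hm
  have hmem := monomial_sub_monomial_mem_toricIdeal (K := K) hw.symm
  have key := homogeneousComponent_mem_idealStar hmem (d := m.degree) fun e he => by
    rw [map_sub, homogeneousComponent_monomial, homogeneousComponent_monomial,
      if_neg (by omega), if_neg (by omega), sub_zero]
  rwa [map_sub, homogeneousComponent_monomial, homogeneousComponent_monomial,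
    if_pos rfl, if_neg (by omega), sub_zero] at key

theorem monomial_sub_monomial_mem_idealStar {m m' : Fin 4 →₀ ℕ} (hm : IsMaxDegree n m)
    (hm' : IsMaxDegree n m') (hw : Finsupp.weight n m = Finsupp.weight n m') :
    (monomial m 1 - monomial m' 1 : MvPolynomial (Fin 4) K) ∈
      idealStar (toricIdeal K n) := by
  have hdeg : m'.degree = m.degree := le_antisymm (hm _ hw.symm) (hm' _ hw)
  have hmem := monomial_sub_monomial_mem_toricIdeal (K := K) hw
  have key := homogeneousComponent_mem_idealStar hmem (d := m.degree) fun e he => by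
    rw [map_sub, homogeneousComponent_monomial, homogeneousComponent_monomial,
      if_neg (by omega), if_neg (by omega), sub_zero]
  rwa [map_sub, homogeneousComponent_monomial, homogeneousComponent_monomial,
    if_pos rfl, if_pos hdeg] at key

theorem mem_idealStar_of_maxDegreePart_eq_zero {p : MvPolynomial (Fin 4) K}
    (hp : maxDegreePart K n p = 0) : p ∈ idealStar (toricIdeal K n) := by
  classical
  have hsec : ∀ s, ∃ c : Fin 4 →₀ ℕ, ∀ m, IsMaxDegree n m → Finsupp.weight n m = s →
      IsMaxDegree n c ∧ Finsupp.weight n c = s := by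
    intro s
    by_cases h : ∃ m, IsMaxDegree n m ∧ Finsupp.weight n m = s
    · obtain ⟨m, hm⟩ := h
      exact ⟨m, fun _ _ _ => hm⟩
    · exact ⟨0, fun m h1 h2 => absurd ⟨m, h1, h2⟩ h⟩
  choose c hc using hsec
  let M : (ℕ →₀ K) →ₗ[K] MvPolynomial (Fin 4) K :=
    Finsupp.linearCombination K fun s => monomial (c s) 1
  have key : ∀ q, q - M (maxDegreePart K n q) ∈ idealStar (toricIdeal K n) := by
    intro q
    induction q using MvPolynomial.induction_on' with
    | monomial m a =>
      rw [maxDegreePart_monomial]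
      split_ifs with h
      · obtain ⟨h1, h2⟩ := hc _ m h rfl
        convert Ideal.mul_mem_left _ (C a)
          (monomial_sub_monomial_mem_idealStar (K := K) h h1 h2.symm) using 1
        simp [M, mul_sub, C_mul_monomial, smul_monomial]
      · convert Ideal.mul_mem_left _ (C a) (monomial_mem_idealStar (K := K) h) using 1
        simp [C_mul_monomial]
    | add p q hp hq =>
      rw [map_add, map_add, add_sub_add_comm]
      exact add_mem hp hq
  simpa [hp] using key p

theorem maxDegreePart_mul_X
    (h : ∀ m, IsMaxDegree n m → IsMaxDegree n (m + Finsupp.single 0 1))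
    (p : MvPolynomial (Fin 4) K) :
    maxDegreePart K n (p * X 0) = (maxDegreePart K n p).mapDomain (· + n 0) := by
  classical
  induction p using MvPolynomial.induction_on' with
  | monomial m a =>
    have hiff : IsMaxDegree n (m + Finsupp.single 0 1) ↔ IsMaxDegree n m := by
      refine ⟨fun hm m' hm' => ?_, h m⟩
      have := hm (m' + Finsupp.single 0 1) (by rw [map_add, map_add, hm'])
      simpa using this
    rw [X, monomial_mul, mul_one, maxDegreePart_monomial, maxDegreePart_monomial]
    simp only [hiff]
    split_ifs
    · rw [Finsupp.mapDomain_single, map_add, Finsupp.weight_single, one_smul]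
    · simp
  | add p q hp hq => rw [add_mul, map_add, map_add, Finsupp.mapDomain_add, hp, hq]

/-- If multiplication by the first variable preserves maximality of the total degree of a
monomial among those of the same weight, then it is a nonzerodivisor on the tangent cone. -/
theorem mk_X_mem_nonZeroDivisors
    (h : ∀ m, IsMaxDegree n m → IsMaxDegree n (m + Finsupp.single 0 1)) :
    Ideal.Quotient.mk (idealStar (toricIdeal K n)) (X 0) ∈
      nonZeroDivisors (MvPolynomial (Fin 4) K ⧸ idealStar (toricIdeal K n)) := by
  rw [mem_nonZeroDivisors_iff_right]
  intro y hy
  obtain ⟨p, rfl⟩ := Ideal.Quotient.mk_surjective y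
  rw [← map_mul, Ideal.Quotient.eq_zero_iff_mem] at hy
  rw [Ideal.Quotient.eq_zero_iff_mem]
  have h0 := maxDegreePart_eq_zero_of_mem hy
  rw [maxDegreePart_mul_X h] at h0
  refine mem_idealStar_of_maxDegreePart_eq_zero
    (Finsupp.mapDomain_injective (add_left_injective (n 0)) ?_)
  rw [h0, Finsupp.mapDomain_zero]

end

/-- An integral solution of the weight equation whose left-hand side involves the first variable
forces a standard monomial on the right-hand side to be reducible. -/
theorem not_reduced_of_weight_eq {a1 a2 a3 a4 u1 u2 u3 u4 α β γ δ b c d : ℕ}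
    (ha1 : 0 < a1) (ha3 : 0 < a3)
    (hA : 0 < a3 * u4 + u3 * a4)
    (h12 : Nat.Coprime a1 a2) (h34 : Nat.Coprime a3 a4)
    (hAB : Nat.Coprime (a3 * u4 + u3 * a4) (a1 * u2 + u1 * a2))
    (hα : 0 < α)
    (hw : α * (a2 * (a3 * u4 + u3 * a4)) + β * (a1 * (a3 * u4 + u3 * a4)) +
        γ * (a4 * (a1 * u2 + u1 * a2)) + δ * (a3 * (a1 * u2 + u1 * a2)) =
      b * (a1 * (a3 * u4 + u3 * a4)) +
        c * (a4 * (a1 * u2 + u1 * a2)) + d * (a3 * (a1 * u2 + u1 * a2)))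
    (hb : b < a2) (hc : c < a3) (hd : d < a4 + u4) : u3 ≤ c ∧ u4 ≤ d := by
  have hABZ : IsCoprime (a3 * u4 + u3 * a4 : ℤ) (a1 * u2 + u1 * a2) := by
    exact_mod_cast Nat.isCoprime_iff_coprime.mpr hAB
  have h12Z : IsCoprime (a1 : ℤ) a2 := Nat.isCoprime_iff_coprime.mpr h12
  have h34Z : IsCoprime (a3 : ℤ) a4 := Nat.isCoprime_iff_coprime.mpr h34
  zify at hw hA ha1 ha3 hα hb hc hd ⊢
  obtain ⟨k, hk⟩ : (a3 * u4 + u3 * a4 : ℤ) ∣ a4 * (c - γ) + a3 * (d - δ) :=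
    hABZ.dvd_of_dvd_mul_left
      (Dvd.intro (a2 * α + a1 * (β - b) : ℤ) (by linear_combination hw))
  have hk' : (a2 * α + a1 * (β - b) : ℤ) = k * (a1 * u2 + u1 * a2) :=
    mul_left_cancel₀ hA.ne' (by linear_combination hw + (a1 * u2 + u1 * a2 : ℤ) * hk)
  obtain ⟨p, hp⟩ : (a1 : ℤ) ∣ α - k * u1 :=
    h12Z.dvd_of_dvd_mul_left (Dvd.intro (b - β + k * u2 : ℤ) (by linear_combination -hk'))
  have hp' : (b - β + k * u2 : ℤ) = a2 * p :=
    mul_left_cancel₀ ha1.ne' (by linear_combination -hk' + (a2 : ℤ) * hp)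
  obtain ⟨q, hq⟩ : (a3 : ℤ) ∣ c - γ - k * u3 :=
    h34Z.dvd_of_dvd_mul_left (Dvd.intro (δ - d + k * u4 : ℤ) (by linear_combination -hk))
  have hq' : (δ - d + k * u4 : ℤ) = a4 * q :=
    mul_left_cancel₀ ha3.ne' (by linear_combination -hk + (a4 : ℤ) * hq)
  have hk1 : 1 ≤ k := by
    by_contra! hk0
    have hk0' : 0 ≤ -k := by omega
    have h1 : 0 ≤ -k * u1 := mul_nonneg hk0' (by positivity)
    have h2 : 0 ≤ -k * u2 := mul_nonneg hk0' (by positivity)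
    have hp1 : 1 ≤ p := pos_of_mul_pos_right (a := (a1 : ℤ)) (by linarith) ha1.le
    have h3 : (a2 : ℤ) ≤ a2 * p := le_mul_of_one_le_right (by positivity) hp1
    linarith
  have h3 : (u3 : ℤ) ≤ k * u3 := le_mul_of_one_le_left (by positivity) hk1
  have h4 : (u4 : ℤ) ≤ k * u4 := le_mul_of_one_le_left (by positivity) hk1
  have hq0 : q ≤ 0 := by
    by_contra! hq0
    have h5 : (a3 : ℤ) ≤ a3 * q := le_mul_of_one_le_right (by positivity) hq0
    linarith
  have hq1 : 0 ≤ q := by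
    by_contra! hq1
    have h5 : (a4 : ℤ) ≤ a4 * -q := le_mul_of_one_le_right (by positivity) (by omega)
    linarith
  obtain rfl : q = 0 := le_antisymm hq0 hq1
  constructor <;> linarith

/-- If a monomial in the last three variables has the same weight as some multiple of the first
variable, then it has the same weight as a multiple of the first variable of no smaller degree. -/
theorem exists_rewrite {a1 a2 a3 a4 u1 u2 u3 u4 : ℕ}
    (ha1 : 0 < a1) (ha3 : 0 < a3)
    (hA : 0 < a3 * u4 + u3 * a4)
    (h12 : Nat.Coprime a1 a2) (h34 : Nat.Coprime a3 a4)
    (hAB : Nat.Coprime (a3 * u4 + u3 * a4) (a1 * u2 + u1 * a2))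
    (h21 : a2 ≤ a1) (h34' : a3 ≤ a4) (hu3 : u3 ≤ a3)
    (hdeg : u3 + a4 + u4 ≤ u1 + u2) (hu : 0 < u1 ∨ a2 ≤ u2)
    {α β γ δ b c d : ℕ} (hα : 0 < α)
    (hw : α * (a2 * (a3 * u4 + u3 * a4)) + β * (a1 * (a3 * u4 + u3 * a4)) +
        γ * (a4 * (a1 * u2 + u1 * a2)) + δ * (a3 * (a1 * u2 + u1 * a2)) =
      b * (a1 * (a3 * u4 + u3 * a4)) +
        c * (a4 * (a1 * u2 + u1 * a2)) + d * (a3 * (a1 * u2 + u1 * a2))) :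
    ∃ α' β' γ' δ' : ℕ, 0 < α' ∧ b + c + d ≤ α' + β' + γ' + δ' ∧
      α' * (a2 * (a3 * u4 + u3 * a4)) + β' * (a1 * (a3 * u4 + u3 * a4)) +
        γ' * (a4 * (a1 * u2 + u1 * a2)) + δ' * (a3 * (a1 * u2 + u1 * a2)) =
      b * (a1 * (a3 * u4 + u3 * a4)) +
        c * (a4 * (a1 * u2 + u1 * a2)) + d * (a3 * (a1 * u2 + u1 * a2)) := by
  -- once the second exponent is at least `a2`, trade `x₂ ^ a2` for `x₁ ^ a1`
  have swap : ∀ α' β' γ' δ' : ℕ, 0 < α' ∨ a2 ≤ β' → b + c + d ≤ α' + β' + γ' + δ' →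
      α' * (a2 * (a3 * u4 + u3 * a4)) + β' * (a1 * (a3 * u4 + u3 * a4)) +
        γ' * (a4 * (a1 * u2 + u1 * a2)) + δ' * (a3 * (a1 * u2 + u1 * a2)) =
      b * (a1 * (a3 * u4 + u3 * a4)) +
        c * (a4 * (a1 * u2 + u1 * a2)) + d * (a3 * (a1 * u2 + u1 * a2)) →
      ∃ α' β' γ' δ' : ℕ, 0 < α' ∧ b + c + d ≤ α' + β' + γ' + δ' ∧
        α' * (a2 * (a3 * u4 + u3 * a4)) + β' * (a1 * (a3 * u4 + u3 * a4)) +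
          γ' * (a4 * (a1 * u2 + u1 * a2)) + δ' * (a3 * (a1 * u2 + u1 * a2)) =
        b * (a1 * (a3 * u4 + u3 * a4)) +
          c * (a4 * (a1 * u2 + u1 * a2)) + d * (a3 * (a1 * u2 + u1 * a2)) := by
    rintro α' β' γ' δ' (h | h) h1 h2
    · exact ⟨α', β', γ', δ', h, h1, h2⟩
    · obtain ⟨β'', rfl⟩ := exists_add_of_le h
      exact ⟨α' + a1, β'', γ', δ', by omega, by omega, by rw [← h2]; ring⟩
  -- reduce the third exponent modulo `a3`
  obtain ⟨r, q, hr, rfl⟩ : ∃ r q, r < a3 ∧ c = r + q * a3 :=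
    ⟨c % a3, c / a3, Nat.mod_lt _ ha3, by rw [mul_comm]; exact (Nat.mod_add_div c a3).symm⟩
  have hq : q * a3 ≤ q * a4 := Nat.mul_le_mul_left q h34'
  have hw' : b * (a1 * (a3 * u4 + u3 * a4)) + (r + q * a3) * (a4 * (a1 * u2 + u1 * a2)) +
        d * (a3 * (a1 * u2 + u1 * a2)) =
      b * (a1 * (a3 * u4 + u3 * a4)) + r * (a4 * (a1 * u2 + u1 * a2)) +
        (d + q * a4) * (a3 * (a1 * u2 + u1 * a2)) := by ring
  obtain hb | hb := le_or_gt a2 b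
  · exact swap 0 b (r + q * a3) d (Or.inr hb) (by omega) (by ring)
  by_cases hd : a4 + u4 ≤ d + q * a4
  · obtain ⟨e, he⟩ := exists_add_of_le hd
    obtain ⟨v, rfl⟩ := exists_add_of_le hu3
    refine swap u1 (b + u2) (r + v) e (by omega) (by omega) ?_
    rw [hw', he]; ring
  · rw [hw'] at hw
    obtain ⟨h3, h4⟩ := not_reduced_of_weight_eq ha1 ha3 hA h12 h34 hAB hα hw hb hr (by omega)
    obtain ⟨e, he⟩ := exists_add_of_le h4
    obtain ⟨v, rfl⟩ := exists_add_of_le h3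
    refine swap u1 (b + u2) v e (by omega) (by omega) ?_
    rw [hw', he]; ring

theorem coprime_of_gcd_eq_one {a1 a2 a3 a4 u1 u2 u3 u4 : ℕ}
    (h : Nat.gcd (Nat.gcd (Nat.gcd (a2 * (a3 * u4 + u3 * a4)) (a1 * (a3 * u4 + u3 * a4)))
      (a4 * (a1 * u2 + u1 * a2))) (a3 * (a1 * u2 + u1 * a2)) = 1) :
    Nat.Coprime a1 a2 ∧ Nat.Coprime a3 a4 ∧
      Nat.Coprime (a3 * u4 + u3 * a4) (a1 * u2 + u1 * a2) := by
  have key : ∀ g, g ∣ a2 * (a3 * u4 + u3 * a4) → g ∣ a1 * (a3 * u4 + u3 * a4) →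
      g ∣ a4 * (a1 * u2 + u1 * a2) → g ∣ a3 * (a1 * u2 + u1 * a2) → g = 1 :=
    fun g h1 h2 h3 h4 => Nat.dvd_one.mp
      (h ▸ Nat.dvd_gcd (Nat.dvd_gcd (Nat.dvd_gcd h1 h2) h3) h4)
  have h12 : Nat.gcd a1 a2 ∣ a1 * u2 + u1 * a2 :=
    dvd_add (Dvd.dvd.mul_right (Nat.gcd_dvd_left _ _) _)
      (Dvd.dvd.mul_left (Nat.gcd_dvd_right _ _) _)
  have h34 : Nat.gcd a3 a4 ∣ a3 * u4 + u3 * a4 :=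
    dvd_add (Dvd.dvd.mul_right (Nat.gcd_dvd_left _ _) _)
      (Dvd.dvd.mul_left (Nat.gcd_dvd_right _ _) _)
  refine ⟨key _ ?_ ?_ ?_ ?_, key _ ?_ ?_ ?_ ?_, key _ ?_ ?_ ?_ ?_⟩
  · exact Dvd.dvd.mul_right (Nat.gcd_dvd_right _ _) _
  · exact Dvd.dvd.mul_right (Nat.gcd_dvd_left _ _) _
  · exact Dvd.dvd.mul_left h12 _
  · exact Dvd.dvd.mul_left h12 _
  · exact Dvd.dvd.mul_left h34 _
  · exact Dvd.dvd.mul_left h34 _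
  · exact Dvd.dvd.mul_right (Nat.gcd_dvd_right _ _) _
  · exact Dvd.dvd.mul_right (Nat.gcd_dvd_left _ _) _
  · exact Dvd.dvd.mul_left (Nat.gcd_dvd_left _ _) _
  · exact Dvd.dvd.mul_left (Nat.gcd_dvd_left _ _) _
  · exact Dvd.dvd.mul_left (Nat.gcd_dvd_right _ _) _
  · exact Dvd.dvd.mul_left (Nat.gcd_dvd_right _ _) _

theorem mk_X_mem_nonZeroDivisors_of_degree_le (K : Type*) [Field K]
    {a1 a2 a3 a4 u1 u2 u3 u4 : ℕ} (ha1 : 0 < a1) (ha3 : 0 < a3)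
    (hA : 0 < a3 * u4 + u3 * a4) (h21 : a2 ≤ a1) (h34 : a3 ≤ a4) (hu3 : u3 ≤ a3)
    (hdeg : u3 + a4 + u4 ≤ u1 + u2) (hu : 0 < u1 ∨ a2 ≤ u2) {n : Fin 4 → ℕ}
    (hn : n = ![a2 * (a3 * u4 + u3 * a4), a1 * (a3 * u4 + u3 * a4),
      a4 * (a1 * u2 + u1 * a2), a3 * (a1 * u2 + u1 * a2)])
    (hgcd : Nat.gcd (Nat.gcd (Nat.gcd (n 0) (n 1)) (n 2)) (n 3) = 1) :
    Ideal.Quotient.mk (idealStar (toricIdeal K n)) (X 0) ∈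
      nonZeroDivisors (MvPolynomial (Fin 4) K ⧸ idealStar (toricIdeal K n)) := by
  have hn0 : n 0 = a2 * (a3 * u4 + u3 * a4) := by rw [hn]; rfl
  have hn1 : n 1 = a1 * (a3 * u4 + u3 * a4) := by rw [hn]; rfl
  have hn2 : n 2 = a4 * (a1 * u2 + u1 * a2) := by rw [hn]; rfl
  have hn3 : n 3 = a3 * (a1 * u2 + u1 * a2) := by rw [hn]; rfl
  have hwt : ∀ m : Fin 4 →₀ ℕ,
      Finsupp.weight n m = m 0 * n 0 + m 1 * n 1 + m 2 * n 2 + m 3 * n 3 := fun m => by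
    rw [Finsupp.weight_apply, Finsupp.sum_fintype _ _ (by simp), Fin.sum_univ_four]; rfl
  have hdg : ∀ m : Fin 4 →₀ ℕ, m.degree = m 0 + m 1 + m 2 + m 3 := fun m => by
    rw [Finsupp.degree_eq_sum, Fin.sum_univ_four]
  rw [hn0, hn1, hn2, hn3] at hgcd
  obtain ⟨h12', h34', hAB⟩ := coprime_of_gcd_eq_one hgcd
  refine mk_X_mem_nonZeroDivisors fun m hm m' hm' => ?_
  -- it suffices to find a monomial of the same weight divisible by the first variable
  obtain ⟨α, β, γ, δ, hα, hle, hw⟩ : ∃ α β γ δ : ℕ, 0 < α ∧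
      m' 0 + m' 1 + m' 2 + m' 3 ≤ α + β + γ + δ ∧
      α * n 0 + β * n 1 + γ * n 2 + δ * n 3 =
        m' 0 * n 0 + m' 1 * n 1 + m' 2 * n 2 + m' 3 * n 3 := by
    obtain h0 | h0 := Nat.eq_zero_or_pos (m' 0)
    · have hw' : (m 0 + 1) * n 0 + m 1 * n 1 + m 2 * n 2 + m 3 * n 3 =
          m' 1 * n 1 + m' 2 * n 2 + m' 3 * n 3 := by
        rw [hwt, hwt, h0] at hm'
        simpa using hm'.symm
      simp only [h0, zero_mul, zero_add]
      rw [hn0, hn1, hn2, hn3] at hw' ⊢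
      exact exists_rewrite ha1 ha3 hA h12' h34' hAB h21 h34 hu3 hdeg hu (Nat.succ_pos _) hw'
    · exact ⟨_, _, _, _, h0, le_rfl, rfl⟩
  obtain ⟨α, rfl⟩ := Nat.exists_eq_add_of_lt hα
  let m'' : Fin 4 →₀ ℕ := Finsupp.equivFunOnFinite.symm ![α, β, γ, δ]
  have e0 : m'' 0 = α := rfl
  have e1 : m'' 1 = β := rfl
  have e2 : m'' 2 = γ := rfl
  have e3 : m'' 3 = δ := rfl
  have hmax := hm m'' <| by
    rw [map_add, Finsupp.weight_single, one_smul, hwt m', ← hw] at hm'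
    rw [hwt m'', e0, e1, e2, e3]
    linarith
  rw [hdg m'', e0, e1, e2, e3] at hmax
  rw [map_add, Finsupp.degree_single, hdg m']
  omega

theorem stmt11 (K : Type*) [Field K] (a1 a2 a3 a4 u1 u2 u3 u4 : ℕ)
    (ha1 : 0 < a1) (ha2 : 0 < a2) (ha3 : 0 < a3) (ha4 : 0 < a4)
    (hu12 : ¬(u1 = 0 ∧ u2 = 0)) (hu34 : ¬(u3 = 0 ∧ u4 = 0))
    (n : Fin 4 → ℕ)
    (hn : n = ![a2 * (a3 * u4 + u3 * a4), a1 * (a3 * u4 + u3 * a4),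
      a4 * (a1 * u2 + u1 * a2), a3 * (a1 * u2 + u1 * a2)])
    (hgcd : Nat.gcd (Nat.gcd (Nat.gcd (n 0) (n 1)) (n 2)) (n 3) = 1)
    (hgen : toricIdeal K n = Ideal.span
      {(X 0 : MvPolynomial (Fin 4) K) ^ a1 - X 1 ^ a2,
       X 2 ^ a3 - X 3 ^ a4,
       X 0 ^ u1 * X 1 ^ u2 - X 2 ^ u3 * X 3 ^ u4})
    (hmin : n 0 ≤ n 1 ∧ n 0 ≤ n 2 ∧ n 0 ≤ n 3)
    (ha34 : a3 < a4) (hu2a2 : u2 ≤ a2) (hu3a3 : u3 ≤ a3)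
    (d1 d2 : Fin 4 → ℕ)
    (hd1 : d1 = ![0, 0, a2 * a4, a2 * a3])
    (hd2 : d2 = ![0, 0, a1 * a4, a1 * a3]) :
    ∃ w0 : ℕ, ∀ w : ℕ, w0 ≤ w →
      (Nat.gcd (Nat.gcd (Nat.gcd (n 0 + w * d1 0) (n 1 + w * d1 1))
          (n 2 + w * d1 2)) (n 3 + w * d1 3) = 1 →
        Ideal.Quotient.mk (idealStar (toricIdeal K (fun j => n j + w * d1 j))) (X 0) ∈
          nonZeroDivisors
            (MvPolynomial (Fin 4) K ⧸ idealStar (toricIdeal K (fun j => n j + w * d1 j)))) ∧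
      (Nat.gcd (Nat.gcd (Nat.gcd (n 0 + w * d2 0) (n 1 + w * d2 1))
          (n 2 + w * d2 2)) (n 3 + w * d2 3) = 1 →
        Ideal.Quotient.mk (idealStar (toricIdeal K (fun j => n j + w * d2 j))) (X 0) ∈
          nonZeroDivisors
            (MvPolynomial (Fin 4) K ⧸ idealStar (toricIdeal K (fun j => n j + w * d2 j)))) := by
  have hA : 0 < a3 * u4 + u3 * a4 := by
    by_contra! h
    have h1 : a3 * u4 = 0 := by omega
    have h2 : u3 * a4 = 0 := by omega
    rw [mul_eq_zero] at h1 h2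
    omega
  have h21 : a2 ≤ a1 := by
    have h := hmin.1
    rw [hn] at h
    exact Nat.le_of_mul_le_mul_right h hA
  refine ⟨u3 + a4 + u4 + a2 + 1, fun w hw => ⟨fun hg => ?_, fun hg => ?_⟩⟩
  · refine mk_X_mem_nonZeroDivisors_of_degree_le (u1 := u1 + w) (u2 := u2) K ha1 ha3 hA h21
      ha34.le hu3a3 (by omega) (Or.inl (by omega)) ?_ hg
    funext j
    fin_cases j <;> simp [hn, hd1] <;> ring
  · refine mk_X_mem_nonZeroDivisors_of_degree_le (u1 := u1) (u2 := u2 + w) K ha1 ha3 hA h21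
      ha34.le hu3a3 (by omega) (Or.inr (by omega)) ?_ hg
    funext j
    fin_cases j <;> simp [hn, hd2] <;> ring
end
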